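/- arXiv:1712.00696 — 2 statements merged into one kernel-verified Lean document; each statement's English description precedes it below -/
import Mathlib

section
/- The hyperbolicity valuation ν_hyp is 2-stable: for all finite nonempty subsets A, B ⊆ ℝ^{4×4}, |ν_hyp(A) − ν_hyp(B)| ≤ 2 · d_H(A, B). Moreover, for every finite metric space X and nonempty σ ⊆ X, hyp(σ) = ν_hyp(K₄(σ)), so the hyperbolicity filtration is 4-local; in particular σ ↦ hyp(σ) is monotone under inclusion of subsets. -/
open Set Metric

/-- The `n`-th curvature set of a subset `σ` of a metric space `X`. -/
def curvSet (X : Type) [MetricSpace X] (n : ℕ) (σ : Set X) :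
    Set (Fin n → Fin n → ℝ) :=
  { A | ∃ x : Fin n → X, (∀ i, x i ∈ σ) ∧ A = fun i j => dist (x i) (x j) }

/-- The hyperbolicity of a subset `σ` of a metric space (with the restricted metric). -/
noncomputable def hypSet {X : Type} [MetricSpace X] (σ : Set X) : ℝ :=
  sSup { t | ∃ x1 ∈ σ, ∃ x2 ∈ σ, ∃ x3 ∈ σ, ∃ x4 ∈ σ,
    t = (dist x1 x2 + dist x3 x4 -
      max (dist x1 x3 + dist x2 x4) (dist x1 x4 + dist x2 x3)) / 2 }

/-- The hyperbolicity valuation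
`ν_hyp(A) = (1/2) max_{a∈A} (a₁₂ + a₃₄ − max{a₁₃ + a₂₄, a₁₄ + a₂₃})`
(indices written `0,1,2,3` in `Fin 4`). -/
noncomputable def nuHyp (A : Set (Fin 4 → Fin 4 → ℝ)) : ℝ :=
  sSup { t | ∃ a ∈ A,
    t = (a 0 1 + a 2 3 - max (a 0 2 + a 1 3) (a 0 3 + a 1 2)) / 2 }

/-- Half the four-point defect of a `4 × 4` matrix. -/
noncomputable def fourPointDefect (a : Fin 4 → Fin 4 → ℝ) : ℝ :=
  (a 0 1 + a 2 3 - max (a 0 2 + a 1 3) (a 0 3 + a 1 2)) / 2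

theorem nuHyp_eq_sSup_image (A : Set (Fin 4 → Fin 4 → ℝ)) :
    nuHyp A = sSup (fourPointDefect '' A) := by
  simp only [nuHyp, fourPointDefect, Set.image, eq_comm]

theorem fourPointDefect_le_add_dist (a b : Fin 4 → Fin 4 → ℝ) :
    fourPointDefect a ≤ fourPointDefect b + 2 * dist a b := by
  have entry (i j : Fin 4) : |a i j - b i j| ≤ dist a b := by
    rw [← Real.dist_eq]
    exact (dist_le_pi_dist (a i) (b i) j).trans (dist_le_pi_dist a b i)
  have h01 := abs_le.1 (entry 0 1)
  have h23 := abs_le.1 (entry 2 3)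
  have h02 := abs_le.1 (entry 0 2)
  have h13 := abs_le.1 (entry 1 3)
  have h03 := abs_le.1 (entry 0 3)
  have h12 := abs_le.1 (entry 1 2)
  have hmax : max (b 0 2 + b 1 3) (b 0 3 + b 1 2) ≤
      max (a 0 2 + a 1 3) (a 0 3 + a 1 2) + 2 * dist a b :=
    max_le (by linarith [le_max_left (a 0 2 + a 1 3) (a 0 3 + a 1 2)])
      (by linarith [le_max_right (a 0 2 + a 1 3) (a 0 3 + a 1 2)])
  unfold fourPointDefect
  linarith

theorem nuHyp_le_add_hausdorffDist {A B : Set (Fin 4 → Fin 4 → ℝ)} (hA : A.Finite)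
    (hB : B.Finite) (hA' : A.Nonempty) (hB' : B.Nonempty) :
    nuHyp A ≤ nuHyp B + 2 * hausdorffDist A B := by
  have fin := hausdorffEDist_ne_top_of_nonempty_of_bounded hA' hB' hA.isBounded hB.isBounded
  rw [nuHyp_eq_sSup_image, nuHyp_eq_sSup_image]
  refine csSup_le (hA'.image _) ?_
  rintro _ ⟨a, ha, rfl⟩
  refine le_of_forall_pos_le_add fun ε hε => ?_
  obtain ⟨b, hb, hab⟩ := exists_dist_lt_of_hausdorffDist_lt ha
    (show hausdorffDist A B < hausdorffDist A B + ε / 2 by linarith) fin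
  have hle := le_csSup (hB.image fourPointDefect).bddAbove (mem_image_of_mem _ hb)
  linarith [fourPointDefect_le_add_dist a b]

theorem hypSet_eq_nuHyp_curvSet {X : Type} [MetricSpace X] (σ : Set X) :
    hypSet σ = nuHyp (curvSet X 4 σ) := by
  unfold hypSet nuHyp
  congr 1
  ext t
  constructor
  · rintro ⟨x1, h1, x2, h2, x3, h3, x4, h4, rfl⟩
    exact ⟨_, ⟨![x1, x2, x3, x4], by simp [Fin.forall_fin_succ, h1, h2, h3, h4], rfl⟩, rfl⟩
  · rintro ⟨_, ⟨x, hx, rfl⟩, rfl⟩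
    exact ⟨x 0, hx 0, x 1, hx 1, x 2, hx 2, x 3, hx 3, rfl⟩

theorem curvSet_mono {X : Type} [MetricSpace X] (n : ℕ) {τ σ : Set X} (h : τ ⊆ σ) :
    curvSet X n τ ⊆ curvSet X n σ := by
  rintro _ ⟨x, hx, rfl⟩
  exact ⟨x, fun i => h (hx i), rfl⟩

theorem curvSet_nonempty {X : Type} [MetricSpace X] (n : ℕ) {σ : Set X} (h : σ.Nonempty) :
    (curvSet X n σ).Nonempty :=
  let ⟨x, hx⟩ := h
  ⟨_, fun _ => x, fun _ => hx, rfl⟩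

theorem curvSet_finite {X : Type} [MetricSpace X] [Finite X] (n : ℕ) (σ : Set X) :
    (curvSet X n σ).Finite := by
  refine (finite_range fun (x : Fin n → X) i j => dist (x i) (x j)).subset ?_
  rintro _ ⟨x, -, rfl⟩
  exact mem_range_self x

theorem nuHyp_mono {A B : Set (Fin 4 → Fin 4 → ℝ)} (hB : B.Finite) (hA : A.Nonempty)
    (h : A ⊆ B) : nuHyp A ≤ nuHyp B := by
  rw [nuHyp_eq_sSup_image, nuHyp_eq_sSup_image]
  exact csSup_le_csSup (hB.image _).bddAbove (hA.image _) (image_mono h)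

/-- `ν_hyp` is 2-stable; for every finite metric space `X` and nonempty
`σ ⊆ X`, `hyp(σ) = ν_hyp(K₄(σ))` (so the hyperbolicity filtration is 4-local); and
`σ ↦ hyp(σ)` is monotone under inclusion of nonempty subsets. -/
theorem nuHyp_two_stable_and_hyp_four_local :
    (∀ A B : Set (Fin 4 → Fin 4 → ℝ), A.Finite → B.Finite → A.Nonempty → B.Nonempty →
      |nuHyp A - nuHyp B| ≤ 2 * hausdorffDist A B) ∧
    (∀ (X : Type) [MetricSpace X] [Fintype X] [Nonempty X] (σ : Set X), σ.Nonempty →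
      hypSet σ = nuHyp (curvSet X 4 σ)) ∧
    (∀ (X : Type) [MetricSpace X] [Fintype X] [Nonempty X] (τ σ : Set X),
      τ.Nonempty → τ ⊆ σ → hypSet τ ≤ hypSet σ) := by
  refine ⟨fun A B hA hB hA' hB' => ?_, fun X _ _ _ σ _ => hypSet_eq_nuHyp_curvSet σ,
    fun X _ _ _ τ σ hτ h => ?_⟩
  · have hAB := nuHyp_le_add_hausdorffDist hA hB hA' hB'
    have hBA := nuHyp_le_add_hausdorffDist hB hA hB' hA'
    rw [hausdorffDist_comm] at hBA
    exact abs_sub_le_iff.2 ⟨by linarith, by linarith⟩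
  · rw [hypSet_eq_nuHyp_curvSet, hypSet_eq_nuHyp_curvSet]
    exact nuHyp_mono (curvSet_finite 4 σ) (curvSet_nonempty 4 hτ) (curvSet_mono 4 h)
end

section
/- Let n, ℓ ≥ 1, L, K ≥ 0. Let X and Y be finite metric spaces and R a correspondence between X and Y with coordinate projections π_X, π_Y. Let ν be a map from pairs (a finite nonempty subset of ℝ^{(n+1)×(n+1)}, a vector in ℝ^ℓ) to ℝ₊ satisfying |ν(A,v) − ν(B,w)| ≤ L·max{d_H(A,B), ‖v−w‖_∞} for all finite nonempty A, B ⊆ ℝ^{(n+1)×(n+1)} and v, w ∈ ℝ^ℓ. Let ρ_X : X → ℝ^ℓ and ρ_Y : Y → ℝ^ℓ satisfy ‖ρ_X(x) − ρ_Y(y)‖_∞ ≤ K·dis(R) for all (x,y) ∈ R. Then for every (x,y) ∈ R and every nonempty σ ⊆ R, |ν(K_n(x, π_X(σ)), ρ_X(x)) − ν(K_n(y, π_Y(σ)), ρ_Y(y))| ≤ L·max{1, K}·dis(R). -/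
open Set Metric

/-- The basepoint `n`-th curvature set `K_n(x₀, σ) ⊆ ℝ^{(n+1)×(n+1)}`: distance
matrices of tuples `(z₀, z₁, …, z_n)` with `z₀ = x₀` and `z₁, …, z_n ∈ σ`. -/
def bCurvSet {X : Type} [MetricSpace X] (n : ℕ) (x₀ : X) (σ : Set X) :
    Set (Fin (n + 1) → Fin (n + 1) → ℝ) :=
  { A | ∃ z : Fin (n + 1) → X, z 0 = x₀ ∧ (∀ i : Fin (n + 1), i ≠ 0 → z i ∈ σ) ∧
      A = fun i j => dist (z i) (z j) }

/-- The distortion of a relation `R ⊆ X × Y`. -/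
noncomputable def dis {X Y : Type} [MetricSpace X] [MetricSpace Y]
    (R : Set (X × Y)) : ℝ :=
  sSup { t | ∃ p ∈ R, ∃ q ∈ R, t = |dist p.1 q.1 - dist p.2 q.2| }

theorem abs_dist_sub_dist_le_dis {X Y : Type} [MetricSpace X] [Finite X]
    [MetricSpace Y] [Finite Y] {R : Set (X × Y)} {p q : X × Y} (hp : p ∈ R) (hq : q ∈ R) :
    |dist p.1 q.1 - dist p.2 q.2| ≤ dis R := by
  refine le_csSup (Set.Finite.bddAbove ?_) ⟨p, hp, q, hq, rfl⟩
  refine (Set.finite_range fun a : (X × Y) × (X × Y) =>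
    |dist a.1.1 a.2.1 - dist a.1.2 a.2.2|).subset ?_
  rintro t ⟨p, -, q, -, rfl⟩
  exact ⟨(p, q), rfl⟩

theorem bCurvSet_finite {X : Type} [MetricSpace X] [Finite X] (n : ℕ) (x₀ : X) (σ : Set X) :
    (bCurvSet n x₀ σ).Finite := by
  refine (Set.finite_range fun (z : Fin (n + 1) → X) i j => dist (z i) (z j)).subset ?_
  rintro A ⟨z, -, -, rfl⟩
  exact ⟨z, rfl⟩

theorem bCurvSet_nonempty {X : Type} [MetricSpace X] (n : ℕ) (x₀ : X) {σ : Set X}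
    (hσ : σ.Nonempty) : (bCurvSet n x₀ σ).Nonempty := by
  obtain ⟨s, hs⟩ := hσ
  exact ⟨_, fun i => if i = 0 then x₀ else s, by simp, fun i hi => by simpa [hi] using hs, rfl⟩

/-- A tuple in a projection of `σ`, based at the projection of `p`, lifts to a tuple in `σ`
based at `p`. -/
theorem exists_lift_tuple {α β : Type} (f : α → β) {n : ℕ} (p : α) (σ : Set α)
    (z : Fin (n + 1) → β) (h0 : z 0 = f p) (hz : ∀ i, i ≠ 0 → z i ∈ f '' σ) :
    ∃ w : Fin (n + 1) → α, w 0 = p ∧ (∀ i, i ≠ 0 → w i ∈ σ) ∧ ∀ i, f (w i) = z i := by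
  have h : ∀ i, ∃ a, (i = 0 → a = p) ∧ (i ≠ 0 → a ∈ σ) ∧ f a = z i := by
    intro i
    by_cases hi : i = 0
    · subst hi
      exact ⟨p, fun _ => rfl, fun h => absurd rfl h, h0.symm⟩
    · obtain ⟨a, ha, hfa⟩ := hz i hi
      exact ⟨a, fun h => absurd h hi, fun _ => ha, hfa⟩
  choose w hw using h
  exact ⟨w, (hw 0).1 rfl, fun i hi => (hw i).2.1 hi, fun i => (hw i).2.2⟩

theorem hausdorffDist_bCurvSet_le {X Y : Type} [MetricSpace X] [Finite X]
    [MetricSpace Y] [Finite Y] (n : ℕ) {R σ : Set (X × Y)} {p : X × Y} (hp : p ∈ R)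
    (hσ : σ ⊆ R) :
    hausdorffDist (bCurvSet n p.1 (Prod.fst '' σ)) (bCurvSet n p.2 (Prod.snd '' σ)) ≤ dis R := by
  have hdis : 0 ≤ dis R := (abs_nonneg _).trans (abs_dist_sub_dist_le_dis hp hp)
  have key : ∀ w : Fin (n + 1) → X × Y, w 0 = p → (∀ i, i ≠ 0 → w i ∈ σ) →
      dist (fun i j => dist (w i).1 (w j).1) (fun i j => dist (w i).2 (w j).2) ≤ dis R := by
    intro w h0 hw
    have hR : ∀ i, w i ∈ R := fun i => by
      by_cases hi : i = 0
      · rw [hi, h0]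
        exact hp
      · exact hσ (hw i hi)
    refine (dist_pi_le_iff hdis).2 fun i => (dist_pi_le_iff hdis).2 fun j => ?_
    rw [Real.dist_eq]
    exact abs_dist_sub_dist_le_dis (hR i) (hR j)
  refine hausdorffDist_le_of_mem_dist hdis ?_ ?_
  · rintro A ⟨z, h0, hz, rfl⟩
    obtain ⟨w, hw0, hw, hwz⟩ := exists_lift_tuple Prod.fst p σ z h0 hz
    refine ⟨_, ⟨fun i => (w i).2, by simp [hw0], fun i hi => ⟨w i, hw i hi, rfl⟩, rfl⟩, ?_⟩
    simpa only [hwz] using key w hw0 hw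
  · rintro A ⟨z, h0, hz, rfl⟩
    obtain ⟨w, hw0, hw, hwz⟩ := exists_lift_tuple Prod.snd p σ z h0 hz
    refine ⟨_, ⟨fun i => (w i).1, by simp [hw0], fun i hi => ⟨w i, hw i hi, rfl⟩, rfl⟩, ?_⟩
    rw [dist_comm]
    simpa only [hwz] using key w hw0 hw

/-- stability of local basepoint filtration values along a correspondence.
Given an `L`-stable adjusted valuation `ν` and point descriptors `ρ_X, ρ_Y` that are
`K`-compatible with the correspondence `R`, for every `(x,y) ∈ R` and every nonempty
`σ ⊆ R`, `|ν(K_n(x, π_X σ), ρ_X x) − ν(K_n(y, π_Y σ), ρ_Y y)| ≤ L·max{1,K}·dis R`. -/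
theorem local_basepoint_stability (n l : ℕ) (hn : 1 ≤ n) (hl : 1 ≤ l)
    (L K : ℝ) (hL : 0 ≤ L) (hK : 0 ≤ K)
    (X Y : Type) [MetricSpace X] [Fintype X] [Nonempty X]
    [MetricSpace Y] [Fintype Y] [Nonempty Y]
    (R : Set (X × Y))
    (hR1 : ∀ x : X, ∃ y : Y, (x, y) ∈ R) (hR2 : ∀ y : Y, ∃ x : X, (x, y) ∈ R)
    (ν : Set (Fin (n + 1) → Fin (n + 1) → ℝ) → (Fin l → ℝ) → ℝ)
    (hν_nonneg : ∀ A, A.Finite → A.Nonempty → ∀ v, 0 ≤ ν A v)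
    (hν_stable : ∀ A B : Set (Fin (n + 1) → Fin (n + 1) → ℝ),
      A.Finite → B.Finite → A.Nonempty → B.Nonempty → ∀ v w : Fin l → ℝ,
      |ν A v - ν B w| ≤ L * max (hausdorffDist A B) (dist v w))
    (ρX : X → Fin l → ℝ) (ρY : Y → Fin l → ℝ)
    (hρ : ∀ x y, (x, y) ∈ R → dist (ρX x) (ρY y) ≤ K * dis R)
    (x : X) (y : Y) (hxy : (x, y) ∈ R)
    (σ : Set (X × Y)) (hσ : σ.Nonempty) (hσR : σ ⊆ R) :
    |ν (bCurvSet n x (Prod.fst '' σ)) (ρX x) -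
      ν (bCurvSet n y (Prod.snd '' σ)) (ρY y)| ≤ L * max 1 K * dis R := by
  have hdis : 0 ≤ dis R := (abs_nonneg _).trans (abs_dist_sub_dist_le_dis hxy hxy)
  refine (hν_stable _ _ (bCurvSet_finite _ _ _) (bCurvSet_finite _ _ _)
    (bCurvSet_nonempty _ _ (hσ.image _)) (bCurvSet_nonempty _ _ (hσ.image _)) _ _).trans ?_
  rw [mul_assoc]
  refine mul_le_mul_of_nonneg_left (max_le ?_ ?_) hL
  · exact (hausdorffDist_bCurvSet_le n hxy hσR).trans
      (le_mul_of_one_le_left hdis (le_max_left _ _))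
  · exact (hρ x y hxy).trans (mul_le_mul_of_nonneg_right (le_max_right _ _) hdis)
end
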